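/- (Interior tangency principle for λ-translating solitons, graph form.) Let D ⊆ ℝ² be a nonempty connected open set, let λ₁, λ₂ ∈ ℝ with λ₂ ≤ λ₁, and suppose u₁ satisfies the λ₁-soliton graph equation on D and u₂ satisfies the λ₂-soliton graph equation on D. If u₂(x) ≥ u₁(x) for every x ∈ D and u₁(p) = u₂(p) for some point p ∈ D, then u₁ = u₂ on all of D (and consequently λ₁ = λ₂). -/

import Mathlib

open MeasureTheory

noncomputable section

/-- The Euclidean plane. -/
abbrev E2 := EuclideanSpace ℝ (Fin 2)

/-- `W u x = √(1 + ‖∇u(x)‖²)`. -/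
noncomputable def W (u : E2 → ℝ) (x : E2) : ℝ := Real.sqrt (1 + ‖gradient u x‖ ^ 2)

/-- The divergence of a vector field `X : ℝ² → ℝ²`: `div X = ∂₁X₁ + ∂₂X₂`. -/
noncomputable def div2 (X : E2 → E2) (x : E2) : ℝ :=
  ∑ i : Fin 2, fderiv ℝ X x (EuclideanSpace.single i 1) i

/-- `u` satisfies the λ-soliton graph equation on the open set `D`: `u` is C² on `D` and
`div (∇u / W(u)) = 2λ + 1/W(u)` at every point of `D`. -/
def SatisfiesSolitonEq (lam : ℝ) (D : Set E2) (u : E2 → ℝ) : Prop :=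
  ContDiffOn ℝ 2 u D ∧
    ∀ x ∈ D, div2 (fun y => (W u y)⁻¹ • gradient u y) x = 2 * lam + (W u x)⁻¹

end

open Set Filter Topology Metric
open scoped RealInnerProductSpace

/-- Rotation of a plane vector by a quarter turn. -/
def quarterTurn (g : E2) : E2 := !₂[g 1, -g 0]

/-- The mean curvature operator in nondivergence form: the contraction of `A` with
`I + (Jg) ⊗ (Jg)`, where `J` is the quarter turn. -/
noncomputable def curvForm (A : E2 →L[ℝ] E2) (g : E2) : ℝ :=
  ∑ i : Fin 2, ⟪A (EuclideanSpace.single i 1), EuclideanSpace.single i 1⟫ +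
    ⟪A (quarterTurn g), quarterTurn g⟫

lemma curvForm_eq (A : E2 →L[ℝ] E2) (g : E2) :
    curvForm A g = (1 + g 1 ^ 2) * A (EuclideanSpace.single 0 1) 0
      + (1 + g 0 ^ 2) * A (EuclideanSpace.single 1 1) 1
      - g 0 * g 1 * (A (EuclideanSpace.single 0 1) 1 + A (EuclideanSpace.single 1 1) 0) := by
  have hJ : quarterTurn g
      = g 1 • EuclideanSpace.single 0 1 - g 0 • EuclideanSpace.single 1 1 := by
    ext i
    fin_cases i <;> simp [quarterTurn]
  simp only [curvForm, hJ, Fin.sum_univ_two, PiLp.inner_apply]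
  simp
  ring

lemma curvForm_nonneg {A : E2 →L[ℝ] E2} (hA : ∀ v, 0 ≤ ⟪A v, v⟫) (g : E2) :
    0 ≤ curvForm A g :=
  add_nonneg (Finset.sum_nonneg fun _ _ => hA _) (hA _)

lemma curvForm_sub (A B : E2 →L[ℝ] E2) (g : E2) :
    curvForm (A - B) g = curvForm A g - curvForm B g := by
  simp only [curvForm_eq, sub_apply, PiLp.sub_apply]
  ring

/-- The difference of the two sides of the soliton equation, multiplied by `W ^ 3`, as a function
of the Hessian and the gradient. -/
noncomputable def solitonDefect (lam : ℝ) (P : (E2 →L[ℝ] E2) × E2) : ℝ :=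
  curvForm P.1 P.2 - 2 * lam * √(1 + ‖P.2‖ ^ 2) ^ 3 - √(1 + ‖P.2‖ ^ 2) ^ 2

lemma contDiff_solitonDefect (lam : ℝ) : ContDiff ℝ 1 (solitonDefect lam) := by
  have hW : ContDiff ℝ 1 fun P : (E2 →L[ℝ] E2) × E2 => √(1 + ‖P.2‖ ^ 2) :=
    ContDiff.sqrt (contDiff_const.add (contDiff_snd.norm_sq ℝ)) fun P => by positivity
  have hg : ∀ i, ContDiff ℝ 1 fun P : (E2 →L[ℝ] E2) × E2 => P.2 i := fun i =>
    (contDiff_piLp_apply (p := 2) (i := i)).comp contDiff_snd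
  have hA : ∀ i j, ContDiff ℝ 1 fun P : (E2 →L[ℝ] E2) × E2 =>
      P.1 (EuclideanSpace.single i 1) j := fun i j =>
    (contDiff_piLp_apply (p := 2) (i := j)).comp (contDiff_fst.clm_apply contDiff_const)
  unfold solitonDefect
  simp only [curvForm_eq]
  fun_prop

lemma exists_solitonDefect_lipschitz (lam K : ℝ) :
    ∃ C : ℝ, 0 ≤ C ∧ ∀ (A : E2 →L[ℝ] E2) (g g' : E2), ‖A‖ ≤ K → ‖g‖ ≤ K → ‖g'‖ ≤ K →
      solitonDefect lam (A, g) - solitonDefect lam (A, g') ≤ C * ‖g - g'‖ := by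
  obtain ⟨C, hC⟩ := ContDiffOn.exists_lipschitzOnWith
    (contDiff_solitonDefect lam).contDiffOn one_ne_zero
    ((convex_closedBall (0 : E2 →L[ℝ] E2) K).prod (convex_closedBall (0 : E2) K))
    ((isCompact_closedBall _ _).prod (isCompact_closedBall _ _))
  refine ⟨C, C.2, fun A g g' hA hg hg' => ?_⟩
  have := hC.dist_le_mul (A, g) (by simp [hA, hg]) (A, g') (by simp [hA, hg'])
  rw [Prod.dist_eq, dist_self, max_eq_right dist_nonneg, Real.dist_eq] at this
  rw [← dist_eq_norm]
  exact (le_abs_self _).trans this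

lemma differentiableAt_gradient {u : E2 → ℝ} {x : E2} (hu : ContDiffAt ℝ 2 u x) :
    DifferentiableAt ℝ (gradient u) x :=
  (InnerProductSpace.toDual ℝ E2).symm.toContinuousLinearEquiv.differentiableAt.comp x
    ((hu.fderiv_right (m := 1) le_rfl).differentiableAt one_ne_zero)

lemma contDiffAt_gradient {u : E2 → ℝ} {x : E2} (hu : ContDiffAt ℝ 2 u x) :
    ContDiffAt ℝ 1 (gradient u) x :=
  (InnerProductSpace.toDual ℝ E2).symm.toContinuousLinearEquiv.contDiff.contDiffAt.comp x
    (hu.fderiv_right (m := 1) le_rfl)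

lemma W_pos (u : E2 → ℝ) (x : E2) : 0 < W u x := by
  unfold W; positivity

lemma W_pow_three_mul_div2 {u : E2 → ℝ} {x : E2} (hu : ContDiffAt ℝ 2 u x) :
    W u x ^ 3 * div2 (fun y => (W u y)⁻¹ • gradient u y) x
      = curvForm (fderiv ℝ (gradient u) x) (gradient u x) := by
  have hH := (differentiableAt_gradient hu).hasFDerivAt
  set H := fderiv ℝ (gradient u) x
  set g := gradient u x with hg
  have hW : HasFDerivAt (W u) _ x := (hH.norm_sq.const_add 1).sqrt (by positivity)
  have hX := (((hasDerivAt_inv (W_pos u x).ne').comp_hasFDerivAt x hW).smul hH).fderiv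
  have hpos := W_pos u x
  have hsq : W u x ^ 2 = 1 + (g 0 ^ 2 + g 1 ^ 2) := by
    rw [W, Real.sq_sqrt (by positivity), EuclideanSpace.real_norm_sq_eq, Fin.sum_univ_two]
  have hWdef : √(1 + ‖g‖ ^ 2) = W u x := rfl
  have : div2 (fun y => (W u y)⁻¹ • gradient u y) x
      = (W u x)⁻¹ * (H (EuclideanSpace.single 0 1) 0 + H (EuclideanSpace.single 1 1) 1)
        - (W u x ^ 3)⁻¹ * ((g 0 * H (EuclideanSpace.single 0 1) 0
            + g 1 * H (EuclideanSpace.single 0 1) 1) * g 0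
          + (g 0 * H (EuclideanSpace.single 1 1) 0
            + g 1 * H (EuclideanSpace.single 1 1) 1) * g 1) := by
    unfold div2
    erw [hX]
    rw [← hg, hWdef]
    simp [Fin.sum_univ_two, PiLp.inner_apply]
    field_simp
    ring
  rw [this, curvForm_eq]
  field_simp
  rw [hsq]
  ring

lemma solitonDefect_eq {lam : ℝ} {D : Set E2} {u : E2 → ℝ} (hD : IsOpen D)
    (h : SatisfiesSolitonEq lam D u) {x : E2} (hx : x ∈ D) (lam' : ℝ) :
    solitonDefect lam' (fderiv ℝ (gradient u) x, gradient u x)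
      = 2 * (lam - lam') * W u x ^ 3 := by
  have h1 := W_pow_three_mul_div2 (h.1.contDiffAt (hD.mem_nhds hx))
  rw [h.2 x hx] at h1
  have hpos := W_pos u x
  have hWdef : √(1 + ‖gradient u x‖ ^ 2) = W u x := rfl
  rw [solitonDefect, ← h1, hWdef]
  field_simp
  ring

lemma IsLocalMin.deriv_deriv_nonneg {f : ℝ → ℝ} {a : ℝ} (h : IsLocalMin f a)
    (hc : ContinuousAt f a) : 0 ≤ deriv (deriv f) a := by
  by_contra! hneg
  have hmax := isLocalMax_of_deriv_deriv_neg hneg h.deriv_eq_zero hc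
  have hconst : f =ᶠ[𝓝 a] fun _ => f a := by
    filter_upwards [h, hmax] with x h1 h2 using le_antisymm h2 h1
  have := hconst.deriv.deriv_eq
  simp at this
  linarith

lemma IsLocalMin.inner_fderiv_gradient_nonneg {f : E2 → ℝ} {y : E2} (h : IsLocalMin f y)
    (hf : ContDiffAt ℝ 2 f y) (v : E2) : 0 ≤ ⟪fderiv ℝ (gradient f) y v, v⟫ := by
  have hline : ∀ t : ℝ, HasDerivAt (fun t : ℝ => y + t • v) v t := fun t => by
    simpa using ((hasDerivAt_id t).smul_const v).const_add y
  have h0 : y + (0 : ℝ) • v = y := by simp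
  have hcont : Tendsto (fun t : ℝ => y + t • v) (𝓝 0) (𝓝 y) := by
    simpa using (hline 0).continuousAt.tendsto
  have hdiff : ∀ᶠ x in 𝓝 y, DifferentiableAt ℝ f x :=
    (hf.eventually (by simp)).mono fun x hx => hx.differentiableAt (by simp)
  have hd1 : deriv (fun t : ℝ => f (y + t • v)) =ᶠ[𝓝 0]
      fun t => ⟪gradient f (y + t • v), v⟫ := by
    filter_upwards [hcont.eventually hdiff] with t ht
    rw [inner_gradient_left]
    exact (ht.hasFDerivAt.comp_hasDerivAt t (hline t)).deriv
  have hg : HasFDerivAt (gradient f) (fderiv ℝ (gradient f) y) (y + (0 : ℝ) • v) := by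
    rw [h0]; exact (differentiableAt_gradient hf).hasFDerivAt
  have hd2 : deriv (deriv fun t : ℝ => f (y + t • v)) 0 = ⟪fderiv ℝ (gradient f) y v, v⟫ := by
    rw [hd1.deriv_eq]
    simpa using ((hg.comp_hasDerivAt 0 (hline 0)).inner ℝ (hasDerivAt_const 0 v)).deriv
  rw [← hd2]
  refine IsLocalMin.deriv_deriv_nonneg ?_ ?_
  · have := hcont.eventually h
    simpa [IsLocalMin, IsMinFilter] using this
  · have : ContinuousAt f (y + (0 : ℝ) • v) := by rw [h0]; exact hf.continuousAt
    exact ContinuousAt.comp (f := fun t : ℝ => y + t • v) this (hline 0).continuousAt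

/-- A Gaussian bump centred at `c`, the barrier of the Hopf lemma. -/
noncomputable def gaussianBump (ε α : ℝ) (c x : E2) : ℝ := ε * Real.exp (-α * ‖x - c‖ ^ 2)

lemma contDiff_gaussianBump (ε α : ℝ) (c : E2) : ContDiff ℝ 2 (gaussianBump ε α c) :=
  contDiff_const.mul (Real.contDiff_exp.comp
    (contDiff_const.mul ((contDiff_id.sub contDiff_const).norm_sq ℝ)))

lemma hasFDerivAt_gaussianBump (ε α : ℝ) (c x : E2) :
    HasFDerivAt (gaussianBump ε α c)
      ((-2 * α * gaussianBump ε α c x) • innerSL ℝ (x - c)) x := by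
  have h := ((((hasFDerivAt_id x).sub_const c).norm_sq.const_mul (-α)).exp).const_mul ε
  refine h.congr_fderiv ?_
  ext v
  simp [gaussianBump]
  ring

lemma gradient_gaussianBump (ε α : ℝ) (c : E2) :
    gradient (gaussianBump ε α c) = fun x => (-2 * α * gaussianBump ε α c x) • (x - c) := by
  funext x
  refine HasGradientAt.gradient ((hasFDerivAt_gaussianBump ε α c x).congr_fderiv ?_)
  ext v
  simp

lemma fderiv_gradient_gaussianBump (ε α : ℝ) (c x v : E2) :
    fderiv ℝ (gradient (gaussianBump ε α c)) x v
      = (-2 * α * gaussianBump ε α c x) • v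
        + (4 * α ^ 2 * gaussianBump ε α c x * ⟪x - c, v⟫) • (x - c) := by
  rw [gradient_gaussianBump]
  have h := ((hasFDerivAt_gaussianBump ε α c x).const_mul (-2 * α)).smul
    ((hasFDerivAt_id x).sub_const c)
  erw [h.fderiv]
  simp [smul_smul, inner_sub_left]
  ring_nf

lemma le_curvForm_gaussianBump {ε : ℝ} (hε : 0 ≤ ε) (α : ℝ) (c x g : E2) :
    gaussianBump ε α c x * (4 * α ^ 2 * ‖x - c‖ ^ 2 - 2 * α * (2 + ‖g‖ ^ 2))
      ≤ curvForm (fderiv ℝ (gradient (gaussianBump ε α c)) x) g := by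
  have hb : 0 ≤ gaussianBump ε α c x := mul_nonneg hε (Real.exp_pos _).le
  have key : curvForm (fderiv ℝ (gradient (gaussianBump ε α c)) x) g
      = gaussianBump ε α c x * (4 * α ^ 2 * ‖x - c‖ ^ 2 - 2 * α * (2 + ‖g‖ ^ 2))
        + gaussianBump ε α c x * (2 * α * ((x - c) 0 * g 1 - (x - c) 1 * g 0)) ^ 2 := by
    simp only [curvForm_eq, fderiv_gradient_gaussianBump, EuclideanSpace.real_norm_sq_eq,
      Fin.sum_univ_two, PiLp.add_apply, PiLp.smul_apply, PiLp.inner_apply]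
    simp
    ring
  rw [key]
  exact le_add_of_nonneg_right (mul_nonneg hb (sq_nonneg _))

lemma gradient_sub_of_contDiffAt {u v : E2 → ℝ} {x : E2} (hu : ContDiffAt ℝ 2 u x)
    (hv : ContDiffAt ℝ 2 v x) : gradient (u - v) x = gradient u x - gradient v x := by
  simp only [gradient]
  rw [fderiv_sub (hu.differentiableAt (by simp)) (hv.differentiableAt (by simp)), map_sub]

lemma fderiv_gradient_sub {u v : E2 → ℝ} {x : E2} (hu : ContDiffAt ℝ 2 u x)
    (hv : ContDiffAt ℝ 2 v x) :
    fderiv ℝ (gradient (u - v)) x = fderiv ℝ (gradient u) x - fderiv ℝ (gradient v) x := by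
  have h : gradient (u - v) =ᶠ[𝓝 x] gradient u - gradient v := by
    filter_upwards [hu.eventually (by simp), hv.eventually (by simp)] with y hy hy'
    exact gradient_sub_of_contDiffAt hy hy'
  rw [h.fderiv_eq, fderiv_sub (differentiableAt_gradient hu) (differentiableAt_gradient hv)]

lemma IsLocalMin.gradient_eq_zero {f : E2 → ℝ} {y : E2} (h : IsLocalMin f y) :
    gradient f y = 0 := by
  simp [gradient, h.fderiv_eq_zero]

/-- The difference of two ordered solutions minus a steep Gaussian bump has no interior minimum. -/
lemma not_isLocalMin_sub_gaussianBump {D : Set E2} (hD : IsOpen D) {lam₁ lam₂ : ℝ}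
    (hle : lam₂ ≤ lam₁) {u₁ u₂ : E2 → ℝ} (h₁ : SatisfiesSolitonEq lam₁ D u₁)
    (h₂ : SatisfiesSolitonEq lam₂ D u₂) {y : E2} (hy : y ∈ D) {K C : ℝ}
    (hC : ∀ (A : E2 →L[ℝ] E2) (g g' : E2), ‖A‖ ≤ K → ‖g‖ ≤ K → ‖g'‖ ≤ K →
      solitonDefect lam₁ (A, g) - solitonDefect lam₁ (A, g') ≤ C * ‖g - g'‖)
    (hA : ‖fderiv ℝ (gradient u₁) y‖ ≤ K) (hg₁ : ‖gradient u₁ y‖ ≤ K)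
    (hg₂ : ‖gradient u₂ y‖ ≤ K) {ε α : ℝ} (hε : 0 < ε) (hα : 0 < α) {c : E2}
    (hlarge : 2 + K ^ 2 + C * ‖y - c‖ < 2 * α * ‖y - c‖ ^ 2) :
    ¬ IsLocalMin (u₂ - u₁ - gaussianBump ε α c) y := by
  intro hmin
  have c₁ := h₁.1.contDiffAt (hD.mem_nhds hy)
  have c₂ := h₂.1.contDiffAt (hD.mem_nhds hy)
  have c₂₁ : ContDiffAt ℝ 2 (u₂ - u₁) y := c₂.sub c₁
  have cb := (contDiff_gaussianBump ε α c).contDiffAt (x := y)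
  have hb : 0 < gaussianBump ε α c y := mul_pos hε (Real.exp_pos _)
  have hgrad := hmin.gradient_eq_zero
  rw [gradient_sub_of_contDiffAt c₂₁ cb, gradient_sub_of_contDiffAt c₂ c₁,
    gradient_gaussianBump, sub_eq_zero] at hgrad
  have hnorm : ‖gradient u₁ y - gradient u₂ y‖ = 2 * α * gaussianBump ε α c y * ‖y - c‖ := by
    rw [norm_sub_rev, hgrad, norm_smul, Real.norm_eq_abs, abs_of_nonpos]
    · ring
    · have := mul_pos hα hb
      linarith
  have hpsd := curvForm_nonneg
    (hmin.inner_fderiv_gradient_nonneg (c₂₁.sub cb)) (gradient u₂ y)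
  rw [fderiv_gradient_sub c₂₁ cb, fderiv_gradient_sub c₂ c₁, curvForm_sub,
    curvForm_sub] at hpsd
  have hbump := le_curvForm_gaussianBump hε.le α c y (gradient u₂ y)
  have hLip := hC _ _ _ hA hg₁ hg₂
  have e₁ := solitonDefect_eq hD h₁ hy lam₁
  have e₂ := solitonDefect_eq hD h₂ hy lam₁
  have hW : 0 < W u₂ y ^ 3 := pow_pos (W_pos _ _) 3
  have hneg : 2 * (lam₂ - lam₁) * W u₂ y ^ 3 ≤ 0 :=
    mul_nonpos_of_nonpos_of_nonneg (by linarith) hW.le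
  have hK : ‖gradient u₂ y‖ ^ 2 ≤ K ^ 2 := by gcongr
  rw [hnorm, e₁] at hLip
  simp only [solitonDefect] at hLip e₂
  have hcontra : 0 < gaussianBump ε α c y * (2 * α)
      * (2 * α * ‖y - c‖ ^ 2 - (2 + ‖gradient u₂ y‖ ^ 2) - C * ‖y - c‖) := by
    apply mul_pos (by positivity)
    linarith
  nlinarith

lemma dist_lt_of_mem_closedBall_midpoint {x z y : E2}
    (hy : ‖y - (1 / 2 : ℝ) • (x + z)‖ ≤ ‖z - x‖ / 2) (hyz : y ≠ z) : ‖y - x‖ < ‖z - x‖ := by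
  have hsum : (y - z) + (y - x) = (2 : ℝ) • (y - (1 / 2 : ℝ) • (x + z)) := by module
  have hdiff : z - x = (y - x) - (y - z) := by abel
  have hle : ‖(y - z) + (y - x)‖ ≤ ‖z - x‖ := by
    rw [hsum, norm_smul, Real.norm_two]
    linarith
  have h1 := norm_add_sq_real (y - z) (y - x)
  have h2 := norm_sub_sq_real (y - x) (y - z)
  rw [← hdiff, real_inner_comm] at h2
  have hpos : 0 < ‖y - z‖ := norm_pos_iff.2 (sub_ne_zero.2 hyz)
  have hsq : ‖(y - z) + (y - x)‖ ^ 2 ≤ ‖z - x‖ ^ 2 := by gcongr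
  refine lt_of_pow_lt_pow_left₀ 2 (norm_nonneg _) ?_
  have := pow_pos hpos 2
  linarith

lemma gaussianBump_lt {ε α : ℝ} (hε : 0 < ε) (hα : 0 < α) {c x y : E2}
    (h : ‖x - c‖ < ‖y - c‖) : gaussianBump ε α c y < gaussianBump ε α c x := by
  refine mul_lt_mul_of_pos_left (Real.exp_lt_exp.2 ?_) hε
  have : ‖x - c‖ ^ 2 < ‖y - c‖ ^ 2 := by gcongr
  nlinarith

lemma gaussianBump_le {ε α : ℝ} (hε : 0 ≤ ε) (hα : 0 ≤ α) (c x : E2) :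
    gaussianBump ε α c x ≤ ε :=
  mul_le_of_le_one_right hε <| Real.exp_le_one_iff.2 <| by
    rw [neg_mul]
    exact neg_nonpos.2 (mul_nonneg hα (sq_nonneg _))

lemma exists_norm_bound {D B : Set E2} (hD : IsOpen D) (hB : IsCompact B) (hBD : B ⊆ D)
    {u : E2 → ℝ} (hu : ContDiffOn ℝ 2 u D) :
    ∃ K, ∀ x ∈ B, ‖gradient u x‖ ≤ K ∧ ‖fderiv ℝ (gradient u) x‖ ≤ K := by
  have h : ∀ x ∈ B, ContDiffAt ℝ 1 (gradient u) x := fun x hx =>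
    contDiffAt_gradient (hu.contDiffAt (hD.mem_nhds (hBD hx)))
  obtain ⟨K₁, hK₁⟩ := hB.exists_bound_of_continuousOn
    fun x hx => (h x hx).continuousAt.continuousWithinAt
  obtain ⟨K₂, hK₂⟩ := hB.exists_bound_of_continuousOn
    fun x hx => ((h x hx).fderiv_right (m := 0) (by simp)).continuousAt.continuousWithinAt
  exact ⟨max K₁ K₂, fun x hx =>
    ⟨(hK₁ x hx).trans (le_max_left _ _), (hK₂ x hx).trans (le_max_right _ _)⟩⟩

/-- If `w` is positive at a point close to a zero `p`, then there is a ball whose closure meets the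
zero set of `w` at exactly one point, which lies on the boundary. -/
lemma exists_touching_ball {w : E2 → ℝ} {p x : E2} {r : ℝ}
    (hw : ContinuousOn w (closedBall p (4 * r))) (hp : w p = 0) (hx : x ∈ ball p r)
    (hwx : w x ≠ 0) :
    ∃ c z : E2, ∃ R : ℝ, 0 < R ∧ ‖z - c‖ = R ∧ w z = 0 ∧
      closedBall z (R / 2) ⊆ closedBall p (4 * r) ∧ ∀ y, ‖y - c‖ ≤ R → y ≠ z → w y ≠ 0 := by
  rw [mem_ball] at hx
  have hr : 0 < r := dist_nonneg.trans_lt hx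
  have hsub : closedBall p (2 * r) ⊆ closedBall p (4 * r) :=
    closedBall_subset_closedBall (by linarith)
  have hS : IsCompact (closedBall p (2 * r) ∩ w ⁻¹' {0}) :=
    (isCompact_closedBall p (2 * r)).of_isClosed_subset
      ((hw.mono hsub).preimage_isClosed_of_isClosed isClosed_closedBall isClosed_singleton)
      inter_subset_left
  obtain ⟨z, ⟨hz, hwz⟩, hmin⟩ := hS.exists_isMinOn
    ⟨p, mem_closedBall_self (by linarith), hp⟩ (f := fun y => ‖y - x‖) (by fun_prop)
  rw [mem_closedBall] at hz
  replace hwz : w z = 0 := hwz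
  have hzp : ‖z - x‖ ≤ ‖p - x‖ := hmin ⟨mem_closedBall_self (by linarith), hp⟩
  rw [← dist_eq_norm p x, dist_comm] at hzp
  have hzx : z ≠ x := fun h => hwx (h ▸ hwz)
  have hpos : 0 < ‖z - x‖ := norm_pos_iff.2 (sub_ne_zero.2 hzx)
  refine ⟨(1 / 2 : ℝ) • (x + z), z, ‖z - x‖ / 2, by positivity, ?_, hwz, ?_, ?_⟩
  · rw [show z - (1 / 2 : ℝ) • (x + z) = (1 / 2 : ℝ) • (z - x) by module, norm_smul]
    norm_num
    ring
  · refine closedBall_subset_closedBall' ?_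
    linarith
  · intro y hy hyz hwy
    have hlt := dist_lt_of_mem_closedBall_midpoint hy hyz
    refine hlt.not_ge (hmin ⟨?_, hwy⟩)
    rw [mem_closedBall]
    have := dist_triangle y x p
    rw [dist_eq_norm y x] at this
    linarith

/-- Two ordered solutions which touch at `p` agree near `p`. -/
lemma eventuallyEq_of_touching {D : Set E2} (hD : IsOpen D) {lam₁ lam₂ : ℝ}
    (hle : lam₂ ≤ lam₁) {u₁ u₂ : E2 → ℝ} (h₁ : SatisfiesSolitonEq lam₁ D u₁)
    (h₂ : SatisfiesSolitonEq lam₂ D u₂) (hord : ∀ x ∈ D, u₁ x ≤ u₂ x) {p : E2} (hp : p ∈ D)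
    (htouch : u₁ p = u₂ p) : u₁ =ᶠ[𝓝 p] u₂ := by
  obtain ⟨ρ, hρ, hρD⟩ := nhds_basis_closedBall.mem_iff.1 (hD.mem_nhds hp)
  obtain ⟨r, hr, rfl⟩ : ∃ r, 0 < r ∧ 4 * r = ρ := ⟨ρ / 4, by positivity, by ring⟩
  obtain ⟨K₁, hK₁⟩ := exists_norm_bound hD (isCompact_closedBall p (4 * r)) hρD h₁.1
  obtain ⟨K₂, hK₂⟩ := exists_norm_bound hD (isCompact_closedBall p (4 * r)) hρD h₂.1
  obtain ⟨C, hC0, hC⟩ := exists_solitonDefect_lipschitz lam₁ (max K₁ K₂)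
  set K := max K₁ K₂
  have hwD : ContinuousOn (u₂ - u₁) D := h₂.1.continuousOn.sub h₁.1.continuousOn
  filter_upwards [ball_mem_nhds p hr] with x hx
  by_contra hne
  obtain ⟨c, z, R, hR, hzc, hwz, hsub, hw⟩ := exists_touching_ball (w := u₂ - u₁)
    (hwD.mono hρD) (by simp [htouch]) hx (sub_ne_zero.2 (Ne.symm hne))
  have hsubD : closedBall z (R / 2) ⊆ D := hsub.trans hρD
  have hnonneg : ∀ y ∈ closedBall z (R / 2), 0 ≤ (u₂ - u₁) y := fun y hy =>
    sub_nonneg.2 (hord y (hsubD hy))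
  have hT : IsCompact (sphere z (R / 2) ∩ closedBall c R) :=
    (isCompact_sphere _ _).inter_right isClosed_closedBall
  obtain ⟨m, hm, hmT⟩ := hT.exists_forall_le' (a := (0 : ℝ))
    (hwD.mono fun y hy => hsubD (sphere_subset_closedBall hy.1)) fun y hy =>
      (hnonneg y (sphere_subset_closedBall hy.1)).lt_of_ne'
        (hw y (mem_closedBall_iff_norm.1 hy.2) (ne_of_mem_sphere hy.1 (by positivity)))
  obtain ⟨α, hα, hlarge⟩ : ∃ α : ℝ, 0 < α ∧ 2 + K ^ 2 + C * (3 * R / 2) < 2 * α * (R / 2) ^ 2 := by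
    refine ⟨(3 + K ^ 2 + C * (3 * R / 2)) / (2 * (R / 2) ^ 2), by positivity, ?_⟩
    field_simp
    linarith
  have hcont : ContinuousOn (u₂ - u₁ - gaussianBump m α c) (closedBall z (R / 2)) :=
    (hwD.mono hsubD).sub (contDiff_gaussianBump m α c).continuous.continuousOn
  have hzmem : z ∈ closedBall z (R / 2) := mem_closedBall_self (by positivity)
  obtain ⟨y, hy, hymin⟩ := (isCompact_closedBall z (R / 2)).exists_isMinOn ⟨z, hzmem⟩ hcont
  have hyz : (u₂ - u₁) y - gaussianBump m α c y ≤ (u₂ - u₁) z - gaussianBump m α c z :=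
    hymin hzmem
  rw [hwz] at hyz
  have hyball : y ∈ ball z (R / 2) := by
    refine (mem_closedBall.1 hy).lt_of_ne fun hys => ?_
    rcases le_or_gt ‖y - c‖ R with hyR | hyR
    · have h1 := hmT y ⟨hys, mem_closedBall_iff_norm.2 hyR⟩
      have h2 := gaussianBump_le hm.le hα.le c y
      have h3 : 0 < gaussianBump m α c z := mul_pos hm (Real.exp_pos _)
      linarith
    · have h1 := hnonneg y hy
      have h2 := gaussianBump_lt hm hα (hzc.trans_lt hyR)
      linarith
  have hyz' : ‖y - z‖ ≤ R / 2 := mem_closedBall_iff_norm.1 hy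
  have hlow : R / 2 ≤ ‖y - c‖ := by
    have := norm_sub_le_norm_sub_add_norm_sub z y c
    rw [norm_sub_rev z y] at this
    linarith
  have hup : ‖y - c‖ ≤ 3 * R / 2 := by
    have := norm_sub_le_norm_sub_add_norm_sub y z c
    linarith
  refine not_isLocalMin_sub_gaussianBump hD hle h₁ h₂ (hsubD hy) hC
    ((hK₁ y (hsub hy)).2.trans (le_max_left _ _)) ((hK₁ y (hsub hy)).1.trans (le_max_left _ _))
    ((hK₂ y (hsub hy)).1.trans (le_max_right _ _)) hm hα (c := c) ?_
    (hymin.isLocalMin (mem_of_superset (isOpen_ball.mem_nhds hyball) ball_subset_closedBall))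
  calc 2 + K ^ 2 + C * ‖y - c‖ ≤ 2 + K ^ 2 + C * (3 * R / 2) := by gcongr
    _ < 2 * α * (R / 2) ^ 2 := hlarge
    _ ≤ 2 * α * ‖y - c‖ ^ 2 := by gcongr

/-- Interior tangency principle for λ-translating solitons, graph form. -/
theorem interior_tangency_principle
    (D : Set E2) (hD : D.Nonempty) (hDopen : IsOpen D) (hDconn : IsConnected D)
    (lam₁ lam₂ : ℝ) (hle : lam₂ ≤ lam₁)
    (u₁ u₂ : E2 → ℝ)
    (h₁ : SatisfiesSolitonEq lam₁ D u₁) (h₂ : SatisfiesSolitonEq lam₂ D u₂)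
    (hord : ∀ x ∈ D, u₁ x ≤ u₂ x)
    (p : E2) (hp : p ∈ D) (htouch : u₁ p = u₂ p) :
    (∀ x ∈ D, u₁ x = u₂ x) ∧ lam₁ = lam₂ := by
  have hloc : ∀ x ∈ D, u₁ x = u₂ x → u₁ =ᶠ[𝓝 x] u₂ := fun x hx hxt =>
    eventuallyEq_of_touching hDopen hle h₁ h₂ hord hx hxt
  have hsub : D ⊆ {x | u₁ =ᶠ[𝓝 x] u₂} := by
    refine hDconn.isPreconnected.subset_of_closure_inter_subset isOpen_setOfPred_eventually_nhds
      ⟨p, hp, hloc p hp htouch⟩ fun x ⟨hxcl, hxD⟩ => hloc x hxD ?_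
    have hcont : ContinuousAt (fun y => (u₁ y, u₂ y)) x :=
      (h₁.1.continuousOn.continuousAt (hDopen.mem_nhds hxD)).prodMk
        (h₂.1.continuousOn.continuousAt (hDopen.mem_nhds hxD))
    exact isClosed_diagonal.mem_of_frequently_of_tendsto
      ((mem_closure_iff_frequently.1 hxcl).mono fun y hy => hy.self_of_nhds) hcont
  refine ⟨fun x hx => (hsub hx).self_of_nhds, ?_⟩
  have hgrad := (hsub hp).gradient
  have hW : W u₁ p = W u₂ p := by rw [W, W, hgrad.self_of_nhds]
  have hfield : (fun y => (W u₁ y)⁻¹ • gradient u₁ y)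
      =ᶠ[𝓝 p] fun y => (W u₂ y)⁻¹ • gradient u₂ y := by
    filter_upwards [hgrad] with y hy
    rw [W, W, hy]
  have e₁ := h₁.2 p hp
  rw [div2, hfield.fderiv_eq, ← div2, h₂.2 p hp, hW] at e₁
  linarith
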